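/- Let v₁ and v₂ be consistently oriented, ultraparallel, unit spacelike vectors in ℝ³ and let p₁, p₂ ∈ ℝ³. The crooked planes C(v₁,p₁) and C(v₂,p₂) are disjoint if and only if (p₂−p₁)·(v₁⊠v₂) > |(p₂−p₁)·v₂| + |(p₂−p₁)·v₁|. -/

import Mathlib

open Matrix

noncomputable section

/-- Minkowski space: ℝ³. -/
abbrev V3 : Type := Fin 3 → ℝ

/-- The Lorentzian inner product `x·y = x₁y₁ + x₂y₂ − x₃y₃`. -/
def mdot (x y : V3) : ℝ := x 0 * y 0 + x 1 * y 1 - x 2 * y 2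

/-- The Lorentzian cross product: the unique bilinear map with
`mdot u (lcross v w) = det [u v w]` (columns `u`, `v`, `w`). -/
def lcross (v w : V3) : V3 :=
  ![v 1 * w 2 - v 2 * w 1, v 2 * w 0 - v 0 * w 2, -(v 0 * w 1 - v 1 * w 0)]

/-- For a spacelike vector `v`, the future-pointing null vector `v⁺` of Euclidean
length 1 which is Lorentz-orthogonal to `v`, where `v⁻, v⁺` are ordered so that
`det[v⁻ v⁺ v] > 0`. -/
def nullPlus (v : V3) : V3 :=
  (1 / (Real.sqrt 2 * (v 0 ^ 2 + v 1 ^ 2))) •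
    ![v 0 * v 2 + v 1 * Real.sqrt (mdot v v),
      v 1 * v 2 - v 0 * Real.sqrt (mdot v v),
      v 0 ^ 2 + v 1 ^ 2]

/-- For a spacelike vector `v`, the future-pointing null vector `v⁻` of Euclidean
length 1 which is Lorentz-orthogonal to `v`, where `v⁻, v⁺` are ordered so that
`det[v⁻ v⁺ v] > 0`. -/
def nullMinus (v : V3) : V3 :=
  (1 / (Real.sqrt 2 * (v 0 ^ 2 + v 1 ^ 2))) •
    ![v 0 * v 2 - v 1 * Real.sqrt (mdot v v),
      v 1 * v 2 + v 0 * Real.sqrt (mdot v v),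
      v 0 ^ 2 + v 1 ^ 2]

/-- `P(x)`: for a future-pointing null vector `x`, the set of spacelike vectors `w`
with `w·x = 0` such that `(w/√(w·w))⁺` is a positive scalar multiple of `x`. -/
def wingSet (x : V3) : Set V3 :=
  {w | 0 < mdot w w ∧ mdot w x = 0 ∧
    ∃ t : ℝ, 0 < t ∧ nullPlus ((Real.sqrt (mdot w w))⁻¹ • w) = t • x}

/-- The crooked plane `C(v,p)`: union of the stem `p + {x | x·v = 0, x·x ≤ 0}`
and the wings `p + P(v⁺)` and `p + P(v⁻)`. -/
def crookedPlane (v p : V3) : Set V3 :=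
  {q | mdot (q - p) v = 0 ∧ mdot (q - p) (q - p) ≤ 0} ∪
  {q | q - p ∈ wingSet (nullPlus v)} ∪
  {q | q - p ∈ wingSet (nullMinus v)}

/-- The crooked half-space `H(v,p)`. -/
def crookedHalf (v p : V3) : Set V3 :=
  {q | (0 ≤ mdot (q - p) v → mdot (q - p) (nullPlus v) ≤ 0) ∧
       (mdot (q - p) v ≤ 0 → 0 ≤ mdot (q - p) (nullMinus v))}

/-- Spacelike vectors `u`, `v` are consistently oriented. -/
def consistentlyOriented (u v : V3) : Prop :=
  mdot u v < 0 ∧ mdot u (nullPlus v) ≤ 0 ∧ mdot u (nullMinus v) ≤ 0 ∧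
  mdot v (nullPlus u) ≤ 0 ∧ mdot v (nullMinus u) ≤ 0

/-- `g` is a linear isometry of the Lorentzian inner product. -/
def isLorentz (g : Matrix (Fin 3) (Fin 3) ℝ) : Prop :=
  ∀ x y : V3, mdot (g.mulVec x) (g.mulVec y) = mdot x y

/-- Membership in `SO(2,1)⁰`, the identity component of the group of linear
isometries of `mdot`: Lorentzian, determinant one, and orthochronous. -/
def inSO21p (g : Matrix (Fin 3) (Fin 3) ℝ) : Prop :=
  isLorentz g ∧ g.det = 1 ∧ 0 < g.mulVec ![0, 0, 1] 2

/-- `g` is hyperbolic: it has three distinct real eigenvalues. -/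
def isHyperbolic (g : Matrix (Fin 3) (Fin 3) ℝ) : Prop :=
  ∃ a b c : ℝ, a ≠ b ∧ a ≠ c ∧ b ≠ c ∧
    g.charpoly = (Polynomial.X - Polynomial.C a) * (Polynomial.X - Polynomial.C b) *
      (Polynomial.X - Polynomial.C c)

/-- `g ≠ I` is parabolic: `1` is its only eigenvalue. -/
def isParabolic (g : Matrix (Fin 3) (Fin 3) ℝ) : Prop :=
  g ≠ 1 ∧ g.charpoly = (Polynomial.X - Polynomial.C 1) ^ 3

/-- `v` is a positive fixed vector of `g`: `gv = v`, `v ≠ 0`, and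
`det[v x gx] > 0` for some null or timelike `x` which is not an eigenvector. -/
def positiveFixed (g : Matrix (Fin 3) (Fin 3) ℝ) (v : V3) : Prop :=
  v ≠ 0 ∧ g.mulVec v = v ∧
  ∃ x : V3, mdot x x ≤ 0 ∧ (∀ t : ℝ, g.mulVec x ≠ t • x) ∧
    0 < mdot v (lcross x (g.mulVec x))

/-- A subgroup of homeomorphisms (here: permutations) of ℝ³ acts properly
discontinuously: for every compact `K`, only finitely many elements move `K`
to meet `K`. -/
def properlyDisc (Γ : Subgroup (Equiv.Perm V3)) : Prop :=
  ∀ K : Set V3, IsCompact K →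
    {f : Equiv.Perm V3 | f ∈ Γ ∧ ((f : V3 → V3) '' K ∩ K).Nonempty}.Finite

/-- The action of `Γ` on ℝ³ is free: no nonidentity element has a fixed point. -/
def freeAction (Γ : Subgroup (Equiv.Perm V3)) : Prop :=
  ∀ f ∈ Γ, f ≠ 1 → ∀ x : V3, f x ≠ x

lemma mdot_add_left (x y z : V3) : mdot (x + y) z = mdot x z + mdot y z := by
  simp only [mdot, Pi.add_apply]; ring

lemma mdot_sub_left (x y z : V3) : mdot (x - y) z = mdot x z - mdot y z := by
  simp only [mdot, Pi.sub_apply]; ring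

lemma mdot_smul_left (c : ℝ) (x y : V3) : mdot (c • x) y = c * mdot x y := by
  simp only [mdot, Pi.smul_apply, smul_eq_mul]; ring

lemma mdot_smul_right (c : ℝ) (x y : V3) : mdot x (c • y) = c * mdot x y := by
  simp only [mdot, Pi.smul_apply, smul_eq_mul]; ring

lemma mdot_neg_right (x y : V3) : mdot x (-y) = -mdot x y := by
  simp only [mdot, Pi.neg_apply]; ring

lemma mdot_neg_neg (x y : V3) : mdot (-x) (-y) = mdot x y := by
  simp only [mdot, Pi.neg_apply]; ring

lemma mdot_comm (x y : V3) : mdot x y = mdot y x := by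
  simp only [mdot]; ring

lemma lcross_swap (u v : V3) : lcross v u = -lcross u v := by
  ext i; fin_cases i <;> simp [lcross] <;> ring

lemma lcross_neg_left (u v : V3) : lcross (-u) v = -lcross u v := by
  ext i; fin_cases i <;> simp [lcross] <;> ring

lemma mdot_lcross_left (u v : V3) : mdot u (lcross u v) = 0 := by
  simp [mdot, lcross]; ring

lemma mdot_lcross_right (u v : V3) : mdot v (lcross u v) = 0 := by
  simp [mdot, lcross]; ring

lemma mdot_lcross_self (u v : V3) :
    mdot (lcross u v) (lcross u v) = mdot u v ^ 2 - mdot u u * mdot v v := by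
  simp [mdot, lcross]; ring

/-- The Gram determinant of three vectors is minus the square of their determinant. -/
lemma gram_det (w v u : V3) :
    mdot w w * (mdot v v * mdot u u - mdot v u ^ 2)
      - mdot w v * (mdot w v * mdot u u - mdot v u * mdot w u)
      + mdot w u * (mdot w v * mdot v u - mdot v v * mdot w u)
      = -mdot w (lcross v u) ^ 2 := by
  simp [mdot, lcross]; ring

/-- A positive multiple of `nullPlus v` for a unit spacelike vector `v`, free of square roots. -/
def nullDir (v : V3) : V3 :=
  ![v 0 * v 2 + v 1, v 1 * v 2 - v 0, v 0 ^ 2 + v 1 ^ 2]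

lemma horizontal_pos {v : V3} (hv : mdot v v = 1) : 0 < v 0 ^ 2 + v 1 ^ 2 := by
  have : v 0 ^ 2 + v 1 ^ 2 = 1 + v 2 ^ 2 := by simp only [mdot] at hv; linarith
  rw [this]; positivity

lemma nullPlus_eq_smul_nullDir {v : V3} (hv : mdot v v = 1) :
    ∃ c : ℝ, 0 < c ∧ nullPlus v = c • nullDir v := by
  have := horizontal_pos hv
  exact ⟨1 / (Real.sqrt 2 * (v 0 ^ 2 + v 1 ^ 2)), by positivity, by
    simp [nullPlus, nullDir, hv]⟩

lemma nullMinus_eq_nullPlus_neg (v : V3) : nullMinus v = nullPlus (-v) := by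
  simp [nullMinus, nullPlus, mdot_neg_neg, sub_eq_add_neg]

lemma mdot_nullPlus_eq_zero_iff {v : V3} (hv : mdot v v = 1) (w : V3) :
    mdot w (nullPlus v) = 0 ↔ mdot w (nullDir v) = 0 := by
  obtain ⟨c, hc, h⟩ := nullPlus_eq_smul_nullDir hv
  rw [h, mdot_smul_right, mul_eq_zero, or_iff_right hc.ne']

lemma smul_eq_smul_nullDir {v d : V3} (hd : mdot d v = 0)
    (h : d 0 * v 1 - d 1 * v 0 = d 2) :
    (v 0 ^ 2 + v 1 ^ 2) • d = d 2 • nullDir v := by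
  simp only [mdot] at hd
  ext i; fin_cases i <;> simp [nullDir]
  · linear_combination v 0 * hd + v 1 * h
  · linear_combination v 1 * hd - v 0 * h
  · ring

lemma eq_add_smul_nullDir {v w : V3} (hv : mdot v v = 1) (h : mdot w (nullDir v) = 0) :
    ∃ b : ℝ, w = mdot w v • v + b • nullDir v := by
  have hN := horizontal_pos hv
  set d := w - mdot w v • v with hd
  have hdv : mdot d v = 0 := by rw [hd, mdot_sub_left, mdot_smul_left, hv]; ring
  have hdN : mdot d (nullDir v) = 0 := by
    rw [hd, mdot_sub_left, mdot_smul_left, h]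
    simp [mdot, nullDir]; right; ring
  have h2 : d 0 * v 1 - d 1 * v 0 = d 2 := by
    clear_value d
    simp [mdot, nullDir] at hv hdv hdN
    linear_combination hdN - v 2 * hdv + d 2 * hv
  refine ⟨(v 0 ^ 2 + v 1 ^ 2)⁻¹ * d 2, ?_⟩
  rw [mul_smul, ← smul_eq_smul_nullDir hdv h2, inv_smul_smul₀ hN.ne', hd]
  abel

lemma mdot_self_add_smul_nullDir {v : V3} (hv : mdot v v = 1) (a b : ℝ) :
    mdot (a • v + b • nullDir v) (a • v + b • nullDir v) = a ^ 2 := by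
  simp [mdot, nullDir] at hv ⊢
  linear_combination (a ^ 2 - b ^ 2 * (v 0 ^ 2 + v 1 ^ 2)) * hv

lemma nullDir_add_smul_nullDir {v : V3} (hv : mdot v v = 1) (b : ℝ) :
    ∃ r : ℝ, 0 < r ∧ nullDir (v + b • nullDir v) = r • nullDir v := by
  refine ⟨(1 + b * v 2) ^ 2 + b ^ 2, ?_, ?_⟩
  · rcases eq_or_ne b 0 with rfl | hb
    · norm_num
    · positivity
  · simp only [mdot] at hv
    ext i; fin_cases i <;> simp [nullDir]
    · linear_combination (b ^ 2 * (v 0 * v 2 + v 1) + b * v 0) * hv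
    · linear_combination (b ^ 2 * (v 1 * v 2 - v 0) + b * v 1) * hv
    · ring

lemma nullDir_neg_not_parallel {v : V3} (hv : mdot v v = 1) {c s : ℝ} (hc : c ≠ 0) :
    c • nullDir (-v) ≠ s • nullDir v := by
  intro h
  have hN := horizontal_pos hv
  have e0 := congrFun h 0
  have e1 := congrFun h 1
  have e2 := congrFun h 2
  simp only [nullDir, Pi.smul_apply, Pi.neg_apply, smul_eq_mul, cons_val_zero, cons_val_one,
    cons_val, neg_sq, neg_mul_neg] at e0 e1 e2
  have hs : c = s := mul_right_cancel₀ hN.ne' e2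
  subst hs
  have hv1 : v 1 = 0 := by linarith [mul_left_cancel₀ hc e0]
  have hv0 : v 0 = 0 := by linarith [mul_left_cancel₀ hc e1]
  simp [hv0, hv1] at hN

lemma mem_wingSet_nullPlus_iff {v : V3} (hv : mdot v v = 1) (w : V3) :
    w ∈ wingSet (nullPlus v) ↔ 0 < mdot w v ∧ mdot w (nullDir v) = 0 := by
  simp only [wingSet, Set.mem_ofPred_eq, mdot_nullPlus_eq_zero_iff hv]
  by_cases h0 : mdot w (nullDir v) = 0
  swap
  · simp [h0]
  obtain ⟨b, hb⟩ := eq_add_smul_nullDir hv h0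
  set a := mdot w v with ha
  have hww : mdot w w = a ^ 2 := by rw [hb, mdot_self_add_smul_nullDir hv]
  simp only [h0, hww, Real.sqrt_sq_eq_abs, true_and, and_true]
  obtain ⟨c, hc, hcv⟩ := nullPlus_eq_smul_nullDir hv
  set u := v + (b / a) • nullDir v with hu
  obtain ⟨r, hr, hru⟩ := nullDir_add_smul_nullDir hv (b / a)
  have hu1 : mdot u u = 1 := by
    simpa [hu] using mdot_self_add_smul_nullDir hv 1 (b / a)
  have hau (h : a ≠ 0) : a⁻¹ • w = u := by
    rw [hb, smul_add, smul_smul, smul_smul, inv_mul_cancel₀ h, one_smul, inv_mul_eq_div]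
  constructor
  · rintro ⟨hpos, t, ht, e⟩
    by_contra hneg
    have ha0 : a < 0 := lt_of_le_of_ne (not_lt.mp hneg) (by intro h; simp [h] at hpos)
    rw [abs_of_neg ha0, inv_neg, neg_smul, hau ha0.ne] at e
    obtain ⟨c', hc', hcu⟩ := nullPlus_eq_smul_nullDir ((mdot_neg_neg u u).trans hu1)
    refine nullDir_neg_not_parallel hu1 (s := t * c / r) hc'.ne' ?_
    rw [← hcu, e, hcv, hru, smul_smul, smul_smul, div_mul_cancel₀ _ hr.ne']
  · intro hpos
    refine ⟨by positivity, ?_⟩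
    rw [abs_of_pos hpos, hau hpos.ne']
    obtain ⟨c', hc', hcu⟩ := nullPlus_eq_smul_nullDir hu1
    refine ⟨c' * r / c, by positivity, ?_⟩
    rw [hcu, hcv, hru, smul_smul, smul_smul, div_mul_cancel₀ _ hc.ne']

/-- The null direction of `v` in terms of a second vector `u` and `v ⊠ u`. -/
lemma mdot_nullDir_eq_zero_iff {v u : V3} (hv : mdot v v = 1)
    (hne : mdot u u ≠ mdot v u ^ 2) (w : V3) :
    mdot w (nullDir v) = 0 ↔
      mdot w u - mdot v u * mdot w v + mdot w (lcross v u) = 0 := by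
  set d := u - mdot v u • v + lcross v u with hd
  have hdw : mdot w d = mdot w u - mdot v u * mdot w v + mdot w (lcross v u) := by
    simp only [hd, mdot_comm w, mdot_add_left, mdot_sub_left, mdot_smul_left]
  have hdv : mdot d v = 0 := by
    rw [hd, mdot_add_left, mdot_sub_left, mdot_smul_left, hv, mdot_comm u, mdot_comm (lcross v u),
      mdot_lcross_left]
    ring
  have hdu : mdot d u = mdot u u - mdot v u ^ 2 := by
    rw [hd, mdot_add_left, mdot_sub_left, mdot_smul_left, mdot_comm (lcross v u),
      mdot_lcross_right]
    ring
  have h2 : d 0 * v 1 - d 1 * v 0 = d 2 := by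
    simp only [mdot] at hv
    simp only [hd, Pi.add_apply, Pi.sub_apply, Pi.smul_apply, smul_eq_mul]
    simp [mdot, lcross]
    linear_combination u 2 * hv
  have key := smul_eq_smul_nullDir hdv h2
  have hN := horizontal_pos hv
  have hd2 : d 2 ≠ 0 := by
    intro h
    rw [h, zero_smul, smul_eq_zero_iff_right hN.ne'] at key
    rw [key] at hdu
    simp [mdot] at hdu hne
    exact hne (by linarith)
  have := congrArg (mdot w) key
  rw [mdot_smul_right, mdot_smul_right] at this
  rw [← hdw]
  constructor
  · intro h
    rw [h, mul_zero] at this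
    exact (mul_eq_zero.mp this).resolve_left hN.ne'
  · intro h
    rw [h, mul_zero] at this
    exact (mul_eq_zero.mp this.symm).resolve_left hd2

/-- The crooked plane with vertex `0` and direction `v`, in the coordinates
`x = w·v`, `y = w·u`, `z = w·(v ⊠ u)`, where `m = v·u`. -/
def crookedCoord (m x y z : ℝ) : Prop :=
  (x = 0 ∧ |z| ≤ |y|) ∨ (0 < x ∧ y - m * x + z = 0) ∨ (x < 0 ∧ y - m * x - z = 0)

lemma mem_crookedPlane_iff {v u : V3} (hv : mdot v v = 1) (hu : mdot u u = 1)
    (hm : 1 < mdot v u ^ 2) (p q : V3) :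
    q ∈ crookedPlane v p ↔ crookedCoord (mdot v u) (mdot (q - p) v) (mdot (q - p) u)
      (mdot (q - p) (lcross v u)) := by
  have hv' : mdot (-v) (-v) = 1 := (mdot_neg_neg v v).trans hv
  have hvu : mdot (-v) u = -mdot v u := by rw [mdot_comm, mdot_neg_right, mdot_comm]
  simp only [crookedPlane, crookedCoord, Set.mem_union, Set.mem_ofPred_eq, or_assoc,
    nullMinus_eq_nullPlus_neg, mem_wingSet_nullPlus_iff hv, mem_wingSet_nullPlus_iff hv']
  rw [mdot_nullDir_eq_zero_iff hv (u := u) (by rw [hu]; exact hm.ne),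
    mdot_nullDir_eq_zero_iff hv' (u := u) (by rw [hu, hvu, neg_sq]; exact hm.ne)]
  simp only [hvu, lcross_neg_left, mdot_neg_right, neg_mul_neg, Left.neg_pos_iff,
    ← sub_eq_add_neg]
  refine or_congr (and_congr_right fun h => ?_) Iff.rfl
  have g := gram_det (q - p) v u
  rw [h, hv, hu] at g
  rw [← sq_le_sq]
  constructor
  · intro hw; nlinarith
  · intro hw; nlinarith

lemma exists_mdot_eq {v u : V3} (hv : mdot v v = 1) (hu : mdot u u = 1)
    (hm : 1 < mdot v u ^ 2) (x y z : ℝ) :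
    ∃ w : V3, mdot w v = x ∧ mdot w u = y ∧ mdot w (lcross v u) = z := by
  have hn := mdot_lcross_self v u
  rw [hv, hu] at hn
  set m := mdot v u with hmd
  have hne : m ^ 2 - 1 ≠ 0 := by linarith
  refine ⟨((m * y - x) / (m ^ 2 - 1)) • v + ((m * x - y) / (m ^ 2 - 1)) • u
    + (z / (m ^ 2 - 1)) • lcross v u, ?_, ?_, ?_⟩ <;>
  simp only [mdot_add_left, mdot_smul_left, mdot_comm (lcross v u) v, mdot_comm (lcross v u) u,
    mdot_comm u v, mdot_lcross_left, mdot_lcross_right, hv, hu, hn, ← hmd] <;>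
  field_simp <;> ring

lemma crookedCoord.le {m x y z : ℝ} (h : crookedCoord m x y z) : z ≤ m * |x| + |y| := by
  rcases h with ⟨rfl, h⟩ | ⟨hx, h⟩ | ⟨hx, h⟩
  · simpa using (le_abs_self z).trans h
  · rw [abs_of_pos hx]
    linarith [neg_abs_le y]
  · rw [abs_of_neg hx]
    linarith [le_abs_self y]

/-- The disjointness criterion in the coordinates of `crookedCoord`. -/
lemma crookedCoord_disjoint_iff {m : ℝ} (hm : m < -1) (a b c : ℝ) :
    (∀ x y z, crookedCoord m x y z → ¬ crookedCoord m (y - b) (x - a) (-(z - c))) ↔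
      |b| + |a| < c := by
  constructor
  · intro h
    by_contra! hc
    rcases le_or_gt (-(|b| + |a|)) c with hc' | hc'
    · have : ∃ z, |z| ≤ |b| ∧ |z - c| ≤ |a| := by
        rcases le_or_gt |c| |b| with h1 | h1
        · exact ⟨c, h1, by simp⟩
        · rcases le_or_gt 0 c with h2 | h2
          · rw [abs_of_nonneg h2] at h1
            exact ⟨|b|, by simp, by rw [abs_le]; constructor <;> linarith⟩
          · rw [abs_of_neg h2] at h1
            exact ⟨-|b|, by simp, by rw [abs_le]; constructor <;> linarith⟩
      obtain ⟨z, h1, h2⟩ := this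
      exact h 0 b z (Or.inl ⟨rfl, h1⟩) (Or.inl ⟨sub_self b, by simpa [abs_sub_comm] using h2⟩)
    · set t := (a - b - c) / (2 * (1 - m)) with ht
      have htpos : 0 < t := by
        have := neg_abs_le a
        have := le_abs_self b
        exact div_pos (by linarith) (by linarith)
      have e : t * (2 * (1 - m)) = a - b - c := div_mul_cancel₀ _ (by linarith)
      exact h t (b + t) (-(b + t - m * t)) (Or.inr (Or.inl ⟨htpos, by ring⟩))
        (Or.inr (Or.inl ⟨by linarith, by linear_combination e⟩))
  · intro h x y z h1 h2
    have e1 := h1.le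
    have e2 := h2.le
    have hx : m * |x| ≤ -|x| := by nlinarith [abs_nonneg x]
    have hy : m * |y - b| ≤ -|y - b| := by nlinarith [abs_nonneg (y - b)]
    have t1 := abs_sub x a
    have t2 := abs_add_le (y - b) b
    rw [sub_add_cancel] at t2
    linarith

/-- Disjointness criterion for crooked planes with consistently
oriented, ultraparallel (i.e. `v₁⊠v₂` spacelike), unit spacelike direction
vectors: `C(v₁,p₁) ∩ C(v₂,p₂) = ∅` iff
`(p₂−p₁)·(v₁⊠v₂) > |(p₂−p₁)·v₂| + |(p₂−p₁)·v₁|`. -/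
theorem crooked_planes_disjoint_iff_ultraparallel
    (v1 v2 p1 p2 : V3)
    (h1 : mdot v1 v1 = 1) (h2 : mdot v2 v2 = 1)
    (hco : consistentlyOriented v1 v2)
    (hultra : 0 < mdot (lcross v1 v2) (lcross v1 v2)) :
    crookedPlane v1 p1 ∩ crookedPlane v2 p2 = ∅ ↔
      |mdot (p2 - p1) v2| + |mdot (p2 - p1) v1| < mdot (p2 - p1) (lcross v1 v2) := by
  have hn := mdot_lcross_self v1 v2
  rw [h1, h2, one_mul] at hn
  have hm2 : 1 < mdot v1 v2 ^ 2 := by linarith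
  have hm : mdot v1 v2 < -1 := by nlinarith [hco.1]
  have hc : mdot v2 v1 = mdot v1 v2 := mdot_comm v2 v1
  rw [← crookedCoord_disjoint_iff hm, Set.eq_empty_iff_forall_notMem]
  simp only [Set.mem_inter_iff, not_and, mem_crookedPlane_iff h1 h2 hm2,
    mem_crookedPlane_iff h2 h1 (hc ▸ hm2), hc, lcross_swap v1 v2, mdot_neg_right]
  have hsub (q u : V3) : mdot (q - p2) u = mdot (q - p1) u - mdot (p2 - p1) u := by
    rw [← mdot_sub_left, sub_sub_sub_cancel_right]
  simp only [hsub]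
  constructor
  · intro h x y z
    obtain ⟨w, rfl, rfl, rfl⟩ := exists_mdot_eq h1 h2 hm2 x y z
    simpa using h (w + p1)
  · intro h q
    exact h _ _ _
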